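/- Let S be an irreducible constraint, presented by an irreducible deterministic labeled graph G whose alphabet Σ is partitioned into nonempty sets Σ0 and Σ1, and let n0 and n1 be positive integers. If an (S,n0,n1)-encoder exists, then there exists a nonnegative nonzero integer vector x indexed by the states of G satisfying componentwise A_{G_0} x ≥ n0 x and A_{G_1} x ≥ n1 x. -/

import Mathlib

open scoped Classical

/-- A finite labeled directed graph over alphabet `A`: a nonempty finite set of
states, a finite set of edges each with an initial and terminal state, and a
labeling of edges by symbols of `A`. -/
structure LGraph (A : Type u) where
  V : Type u
  [fintypeV : Fintype V]
  [nonemptyV : Nonempty V]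
  E : Type u
  [fintypeE : Fintype E]
  src : E → V
  dst : E → V
  lab : E → A

attribute [instance] LGraph.fintypeV LGraph.nonemptyV LGraph.fintypeE

namespace LGraph

variable {A : Type*}

/-- `G.IsWalk u es` : `es` is a sequence of consecutive edges starting at `u`. -/
def IsWalk (G : LGraph A) : G.V → List G.E → Prop
  | _, [] => True
  | u, e :: es => G.src e = u ∧ G.IsWalk (G.dst e) es

/-- The terminal state of a walk. -/
def endState (G : LGraph A) : G.V → List G.E → G.V
  | u, [] => u
  | _, e :: es => G.endState (G.dst e) es

/-- The constraint `S(G)` presented by `G`: all words generated by finite paths. -/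
def constraint (G : LGraph A) : Set (List A) :=
  { w | ∃ u es, G.IsWalk u es ∧ es.map G.lab = w }

/-- No state has two distinct outgoing edges with the same label. -/
def Deterministic (G : LGraph A) : Prop :=
  ∀ e e' : G.E, G.src e = G.src e' → G.lab e = G.lab e' → e = e'

/-- No two distinct paths with the same initial state and the same terminal
state generate the same word. -/
def Lossless (G : LGraph A) : Prop :=
  ∀ (u : G.V) (es es' : List G.E), G.IsWalk u es → G.IsWalk u es' →
    G.endState u es = G.endState u es' → es.map G.lab = es'.map G.lab → es = es'

/-- Strong connectivity. -/
def Irreducible (G : LGraph A) : Prop :=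
  ∀ u v : G.V, ∃ es : List G.E, G.IsWalk u es ∧ G.endState u es = v

/-- Primitivity (in the equivalent form: some power of the adjacency matrix is
entrywise positive, i.e. there is a uniform positive length `ℓ` such that any
state can be reached from any state by a walk of length `ℓ`). -/
def Primitive (G : LGraph A) : Prop :=
  ∃ ℓ : ℕ, 0 < ℓ ∧ ∀ u v : G.V, ∃ es : List G.E,
    G.IsWalk u es ∧ es.length = ℓ ∧ G.endState u es = v

/-- The adjacency matrix of the subgraph of `G` consisting of the edges whose
labels lie in `P`: its `(u,v)` entry is the number of edges from `u` to `v`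
with label in `P`. -/
noncomputable def subAdj (G : LGraph A) (P : Set A) : G.V → G.V → ℕ :=
  fun u v => Nat.card {e : G.E // G.src e = u ∧ G.dst e = v ∧ G.lab e ∈ P}

/-- Every state has exactly `n` outgoing edges with label in `P`. -/
def OutDeg (G : LGraph A) (P : Set A) (n : ℕ) : Prop :=
  ∀ u : G.V, Nat.card {e : G.E // G.src e = u ∧ G.lab e ∈ P} = n

/-- An `(S, n0, n1)`-encoder with respect to the even/odd symbol sets `S0, S1`:
a lossless graph whose constraint is contained in `S` and in which every state
has exactly `n0` outgoing edges with even labels and exactly `n1` outgoing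
edges with odd labels. -/
def IsEncoder (En : LGraph A) (S : Set (List A)) (S0 S1 : Set A) (n0 n1 : ℕ) : Prop :=
  En.Lossless ∧ En.constraint ⊆ S ∧ En.OutDeg S0 n0 ∧ En.OutDeg S1 n1

/-- `x ∈ X(A_{G_0}, A_{G_1}, n0, n1)`: a nonnegative nonzero integer vector with
`A_{G_0} x ≥ n0 x` and `A_{G_1} x ≥ n1 x` componentwise. -/
def InX (G : LGraph A) (S0 S1 : Set A) (n0 n1 : ℕ) (x : G.V → ℕ) : Prop :=
  x ≠ 0 ∧ (∀ u, n0 * x u ≤ ∑ v, G.subAdj S0 u v * x v)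
        ∧ (∀ u, n1 * x u ≤ ∑ v, G.subAdj S1 u v * x v)

/-- The graph has anticipation at most `a`: all paths from a common state that
generate the same word of length `a+1` share the same first edge. -/
def AnticipationAtMost (G : LGraph A) (a : ℕ) : Prop :=
  ∀ (u : G.V) (es es' : List G.E), G.IsWalk u es → G.IsWalk u es' →
    es.length = a + 1 → es'.length = a + 1 → es.map G.lab = es'.map G.lab →
    es.head? = es'.head?

/-- The graph has memory at most `μ`: all paths of length `μ` generating the
same word terminate in the same state. -/
def MemoryAtMost (G : LGraph A) (μ : ℕ) : Prop :=
  ∀ (u u' : G.V) (es es' : List G.E), G.IsWalk u es → G.IsWalk u' es' →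
    es.length = μ → es'.length = μ → es.map G.lab = es'.map G.lab →
    G.endState u es = G.endState u' es'

/-- `(m,a)`-definiteness: all paths generating a given word of length `m+a+1`
share the same `(m+1)`-st edge. -/
def Definite (G : LGraph A) (m a : ℕ) : Prop :=
  ∀ (u u' : G.V) (es es' : List G.E), G.IsWalk u es → G.IsWalk u' es' →
    es.length = m + a + 1 → es'.length = m + a + 1 → es.map G.lab = es'.map G.lab →
    es[m]? = es'[m]?

end LGraph

namespace LGraph

variable {A : Type*}

/-- The follower set of a state: the words generated by walks from that state. -/
def followers (G : LGraph A) (v : G.V) : Set (List A) :=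
  { w | ∃ es, G.IsWalk v es ∧ es.map G.lab = w }

/-- The states in which a walk from `u` generating `w` can end. -/
noncomputable def reached (G : LGraph A) (u : G.V) (w : List A) : Finset G.V :=
  Finset.univ.filter fun v => ∃ es, G.IsWalk u es ∧ G.endState u es = v ∧ es.map G.lab = w

/-- The largest number of states of `En` reached from `u` along a word all of whose
continuations from `u` can be generated in `G` from `t`. -/
noncomputable def weight (G En : LGraph A) (u : En.V) (t : G.V) : ℕ :=
  sSup { k | ∃ w, (En.reached u w).card = k ∧
    ∀ w', w ++ w' ∈ En.followers u → w' ∈ G.followers t }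

theorem isWalk_append (G : LGraph A) (u : G.V) (es fs : List G.E) :
    G.IsWalk u (es ++ fs) ↔ G.IsWalk u es ∧ G.IsWalk (G.endState u es) fs := by
  induction es generalizing u with
  | nil => simp [IsWalk, endState]
  | cons e es ih => simp [IsWalk, endState, ih, and_assoc]

theorem endState_append (G : LGraph A) (u : G.V) (es fs : List G.E) :
    G.endState u (es ++ fs) = G.endState (G.endState u es) fs := by
  induction es generalizing u with
  | nil => simp [endState]
  | cons e es ih => simp [endState, ih]

theorem mem_reached {G : LGraph A} {u v : G.V} {w : List A} :
    v ∈ G.reached u w ↔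
      ∃ es, G.IsWalk u es ∧ G.endState u es = v ∧ es.map G.lab = w := by
  simp [reached]

theorem mem_followers_of_append {G : LGraph A} {v : G.V} {w w' : List A}
    (h : w ++ w' ∈ G.followers v) : w ∈ G.followers v := by
  obtain ⟨es, hes, hw⟩ := h
  obtain ⟨l₁, l₂, rfl, rfl, -⟩ := List.map_eq_append_iff.1 hw
  exact ⟨l₁, ((G.isWalk_append _ _ _).1 hes).1, rfl⟩

/-- In a deterministic graph, the walk from a given state generating a given word is unique. -/
theorem Deterministic.walk_unique {G : LGraph A} (h : G.Deterministic) (u : G.V)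
    (es fs : List G.E) (hes : G.IsWalk u es) (hfs : G.IsWalk u fs)
    (hl : es.map G.lab = fs.map G.lab) : es = fs := by
  induction es generalizing u fs with
  | nil => simpa [eq_comm] using hl
  | cons e es ih =>
    cases fs with
    | nil => simp at hl
    | cons f fs =>
      simp only [List.map_cons, List.cons.injEq] at hl
      obtain rfl := h e f (hes.1.trans hfs.1.symm) hl.1
      rw [ih _ fs hes.2 hfs.2 hl.2]

theorem Deterministic.mem_followers_endState {G : LGraph A} (h : G.Deterministic) {v : G.V}
    {es : List G.E} (hes : G.IsWalk v es) {w' : List A}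
    (hw : es.map G.lab ++ w' ∈ G.followers v) : w' ∈ G.followers (G.endState v es) := by
  obtain ⟨fs, hfs, hl⟩ := hw
  obtain ⟨l₁, l₂, rfl, h₁, h₂⟩ := List.map_eq_append_iff.1 hl
  rw [isWalk_append] at hfs
  obtain rfl := h.walk_unique v l₁ es hfs.1 hes h₁
  exact ⟨l₂, hfs.2, h₂⟩

theorem bddAbove_weight (G En : LGraph A) (u : En.V) (t : G.V) :
    BddAbove { k | ∃ w, (En.reached u w).card = k ∧
      ∀ w', w ++ w' ∈ En.followers u → w' ∈ G.followers t } := by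
  refine ⟨Fintype.card En.V, ?_⟩
  rintro _ ⟨w, rfl, -⟩
  exact Finset.card_le_univ _

theorem card_reached_le_weight {G En : LGraph A} {u : En.V} {t : G.V} {w : List A}
    (h : ∀ w', w ++ w' ∈ En.followers u → w' ∈ G.followers t) :
    (En.reached u w).card ≤ G.weight En u t :=
  le_csSup (bddAbove_weight G En u t) ⟨w, rfl, h⟩

/-- Some state of `G` generates all continuations, from a state `u` of `En`, of some word
generated from `u`. -/
theorem exists_followers_residual {G En : LGraph A} (hdet : G.Deterministic)
    (hsub : En.constraint ⊆ G.constraint) (u : En.V) :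
    ∃ w ∈ En.followers u, ∃ t : G.V,
      ∀ w', w ++ w' ∈ En.followers u → w' ∈ G.followers t := by
  let starts : List A → Finset G.V := fun w => Finset.univ.filter fun v => w ∈ G.followers v
  have hne : (En.followers u).Nonempty := ⟨[], [], trivial, rfl⟩
  obtain ⟨w, hw, hmin⟩ : ∃ w ∈ En.followers u, ∀ w' ∈ En.followers u,
      (starts w).card ≤ (starts w').card :=
    ⟨_, Function.argminOn_mem (fun w => (starts w).card) _ hne,
      fun _ h => Function.argminOn_le (fun w => (starts w).card) _ h⟩
  obtain ⟨v, es, hes, hl⟩ : w ∈ G.constraint := by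
    obtain ⟨fs, hfs, hl⟩ := hw
    exact hsub ⟨u, fs, hfs, hl⟩
  refine ⟨w, hw, G.endState v es, fun w' hw' => ?_⟩
  have heq : starts (w ++ w') = starts w := by
    refine Finset.eq_of_subset_of_card_le (fun s hs => ?_) (hmin _ hw')
    simp only [starts, Finset.mem_filter, Finset.mem_univ, true_and] at hs ⊢
    exact mem_followers_of_append hs
  have hv : v ∈ starts (w ++ w') := by
    rw [heq]
    simp only [starts, Finset.mem_filter, Finset.mem_univ, true_and]
    exact ⟨es, hes, hl⟩
  refine hdet.mem_followers_endState hes ?_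
  rw [hl]
  simpa [starts] using hv

/-- In a lossless graph, edges with the same label leaving states reached along the same word
have distinct terminal states. -/
theorem Lossless.card_edges_le {En : LGraph A} (h : En.Lossless) (u : En.V) (w : List A) (a : A) :
    (Finset.univ.filter fun d => En.src d ∈ En.reached u w ∧ En.lab d = a).card ≤
      (En.reached u (w ++ [a])).card := by
  refine Finset.card_le_card_of_injOn En.dst ?_ ?_
  · intro d hd
    simp only [Finset.coe_filter, Finset.mem_univ, true_and, Set.mem_ofPred_eq] at hd
    obtain ⟨es, h₁, h₂, h₃⟩ := mem_reached.1 hd.1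
    refine mem_reached.2 ⟨es ++ [d], ?_, ?_, ?_⟩
    · simp [isWalk_append, h₁, h₂, IsWalk]
    · simp [endState_append, endState]
    · simp [h₃, hd.2]
  · intro d hd d' hd' hdd
    simp only [Finset.coe_filter, Finset.mem_univ, true_and, Set.mem_ofPred_eq] at hd hd'
    obtain ⟨es, h₁, h₂, h₃⟩ := mem_reached.1 hd.1
    obtain ⟨es', h₁', h₂', h₃'⟩ := mem_reached.1 hd'.1
    have key := h u (es ++ [d]) (es' ++ [d'])
      (by simp [isWalk_append, h₁, h₂, IsWalk]) (by simp [isWalk_append, h₁', h₂', IsWalk])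
      (by simpa [endState_append, endState] using hdd) (by simp [h₃, h₃', hd.2, hd'.2])
    simpa using (List.append_inj' key rfl).2

/-- A row of a subgraph adjacency matrix applied to a vector, as a sum over outgoing edges. -/
theorem sum_subAdj_mul (G : LGraph A) (P : Set A) (t : G.V) (x : G.V → ℕ) :
    ∑ v, G.subAdj P t v * x v =
      ∑ e ∈ Finset.univ.filter (fun e => G.src e = t ∧ G.lab e ∈ P), x (G.dst e) := by
  rw [← Finset.sum_fiberwise (g := G.dst)]
  refine Finset.sum_congr rfl fun v _ => ?_
  rw [Finset.sum_congr rfl (g := fun _ => x v)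
    (fun e he => by rw [(Finset.mem_filter.1 he).2]), Finset.sum_const, smul_eq_mul]
  congr 1
  rw [subAdj, Nat.card_eq_fintype_card, Fintype.card_subtype, Finset.filter_filter]
  congr 1
  ext e
  simp only [Finset.mem_filter]
  tauto

theorem OutDeg.card_edges {En : LGraph A} {P : Set A} {n : ℕ} (h : En.OutDeg P n)
    (Z : Finset En.V) :
    (Finset.univ.filter fun d => En.src d ∈ Z ∧ En.lab d ∈ P).card = n * Z.card := by
  rw [Finset.card_eq_sum_card_fiberwise (f := En.src) (t := Z)
    (fun d hd => by simp at hd; exact hd.1), mul_comm, ← smul_eq_mul, ← Finset.sum_const]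
  refine Finset.sum_congr rfl fun z hz => ?_
  rw [← h z, Nat.card_eq_fintype_card, Fintype.card_subtype, Finset.filter_filter]
  congr 1
  ext e
  simp only [Finset.mem_filter]
  constructor
  · tauto
  · rintro ⟨h₁, rfl, h₂⟩
    tauto

theorem mul_weight_le {G En : LGraph A} (hdet : G.Deterministic) (hll : En.Lossless)
    {P : Set A} {n : ℕ} (hdeg : En.OutDeg P n) (u : En.V)
    (t : G.V) : n * G.weight En u t ≤ ∑ v, G.subAdj P t v * G.weight En u v := by
  by_cases hne : { k | ∃ w, (En.reached u w).card = k ∧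
      ∀ w', w ++ w' ∈ En.followers u → w' ∈ G.followers t }.Nonempty
  swap
  · rw [weight, Set.not_nonempty_iff_eq_empty.1 hne]
    simp
  obtain ⟨w, hcard, hw⟩ := Nat.sSup_mem hne (bddAbove_weight G En u t)
  change _ = G.weight En u t at hcard
  rw [← hcard, sum_subAdj_mul, ← hdeg.card_edges]
  have hedge : ∀ d : En.E, En.src d ∈ En.reached u w →
      ∃ e : G.E, G.src e = t ∧ G.lab e = En.lab d := by
    intro d hd
    obtain ⟨es, h₁, h₂, h₃⟩ := mem_reached.1 hd
    obtain ⟨fs, hfs, hl⟩ := hw [En.lab d]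
      ⟨es ++ [d], by simp [isWalk_append, h₁, h₂, IsWalk], by simp [h₃]⟩
    obtain ⟨e, rfl, he⟩ := List.map_eq_singleton_iff.1 hl
    exact ⟨e, hfs.1, he⟩
  have hle : (Finset.univ.filter fun d => En.src d ∈ En.reached u w ∧ En.lab d ∈ P) ⊆
      (Finset.univ.filter fun e => G.src e = t ∧ G.lab e ∈ P).biUnion fun e =>
        Finset.univ.filter fun d => En.src d ∈ En.reached u w ∧ En.lab d = G.lab e := by
    intro d hd
    simp only [Finset.mem_filter, Finset.mem_univ, true_and, Finset.mem_biUnion] at hd ⊢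
    obtain ⟨e, he, hl⟩ := hedge d hd.1
    exact ⟨e, ⟨he, hl ▸ hd.2⟩, hd.1, hl.symm⟩
  refine (Finset.card_le_card hle).trans (Finset.card_biUnion_le.trans ?_)
  refine Finset.sum_le_sum fun e he => (hll.card_edges_le u w _).trans ?_
  simp only [Finset.mem_filter, Finset.mem_univ, true_and] at he
  refine card_reached_le_weight fun w' hw' => ?_
  refine hdet.mem_followers_endState (v := t) (es := [e]) ⟨he.1, trivial⟩ ?_
  exact hw _ (by simpa using hw')

end LGraph

/-- If an `(S,n0,n1)`-encoder exists for the irreducible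
constraint `S` presented by the irreducible deterministic graph `G`, then
there is a nonnegative nonzero integer vector `x` indexed by the states of `G`
with `A_{G_0} x ≥ n0 x` and `A_{G_1} x ≥ n1 x` componentwise. -/
theorem bimodal_encoder_necessary {A : Type*} (G : LGraph A) (S0 S1 : Set A)
    (hS0 : S0.Nonempty) (hS1 : S1.Nonempty) (hdisj : Disjoint S0 S1)
    (hcover : S0 ∪ S1 = Set.univ)
    (hdet : G.Deterministic) (hirr : G.Irreducible)
    (n0 n1 : ℕ) (hn0 : 0 < n0) (hn1 : 0 < n1)
    (En : LGraph A) (hEn : LGraph.IsEncoder En G.constraint S0 S1 n0 n1) :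
    ∃ x : G.V → ℕ, G.InX S0 S1 n0 n1 x := by
  obtain ⟨hll, hsub, hdeg0, hdeg1⟩ := hEn
  obtain ⟨u⟩ := En.nonemptyV
  refine ⟨G.weight En u, fun h0 => ?_, LGraph.mul_weight_le hdet hll hdeg0 u,
    LGraph.mul_weight_le hdet hll hdeg1 u⟩
  obtain ⟨w, ⟨es, hes, hl⟩, t, ht⟩ := LGraph.exists_followers_residual hdet hsub u
  have hle := LGraph.card_reached_le_weight ht
  rw [h0, Pi.zero_apply, Nat.le_zero, Finset.card_eq_zero] at hle
  exact Finset.notMem_empty (En.endState u es)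
    (hle ▸ LGraph.mem_reached.2 ⟨es, hes, rfl, hl⟩)
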